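/- There exists a constant c > 0 such that the following holds for every constant ε > 0 and all sufficiently large n. Let a, b ≥ 1 with d := a + b satisfying 5·log n < d < n^{1/3 − ε}, and let G be drawn from the stochastic block model G_{2n, a/n, b/n} with degrees d_1,…,d_{2n}. Then with probability at least 1 − n^{−c}, the sum over all vertices j of (sqrt(d) − sqrt(d_j))² is at most 4n. -/

import Mathlib

open MeasureTheory

/-- The Bernoulli measure on `Bool` with parameter `p`. -/
noncomputable def bern (p : ℝ) : Measure Bool :=
  p.toNNReal • Measure.dirac true + (1 - p).toNNReal • Measure.dirac false

/-- The stochastic block model `G_{2n,p,q}`: a symmetric random graph on `2n` vertices,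
encoded by independent Bernoulli edge indicators `ω i j` (only the coordinates with
`i ≤ j` are used by `adjOf`), where the pair `{i,j}` (self-loop pairs included) is an
edge with probability `p` if `i,j` are in the same community (`V₁ = {i | i < n}`,
`V₂ = {i | n ≤ i}`) and with probability `q` otherwise. -/
noncomputable def sbm (n : ℕ) (p q : ℝ) :
    Measure (Fin (2 * n) → Fin (2 * n) → Bool) :=
  Measure.pi fun i => Measure.pi fun j =>
    bern (if i.val < n ↔ j.val < n then p else q)

/-- The (symmetric, 0/1) adjacency matrix determined by the edge indicators `ω`. -/
noncomputable def adjOf {m : ℕ} (ω : Fin m → Fin m → Bool) : Matrix (Fin m) (Fin m) ℝ :=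
  Matrix.of fun i j => if i ≤ j then (if ω i j then 1 else 0) else (if ω j i then 1 else 0)

/-- The degree of vertex `i`. -/
noncomputable def deg {m : ℕ} (ω : Fin m → Fin m → Bool) (i : Fin m) : ℝ :=
  ∑ j, adjOf ω i j

/-- The spectral norm (ℓ²-operator norm) of a square real matrix. -/
noncomputable def specNorm {m : ℕ} (M : Matrix (Fin m) (Fin m) ℝ) : ℝ :=
  ‖Matrix.toEuclideanCLM (𝕜 := ℝ) M‖

/-- The expectation matrix `B = 𝔼[A]`: entries `a/n` within communities, `b/n` across. -/
noncomputable def Bmat (n : ℕ) (a b : ℝ) : Matrix (Fin (2*n)) (Fin (2*n)) ℝ :=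
  Matrix.of fun i j => if i.val < n ↔ j.val < n then a / n else b / n

open ProbabilityTheory Finset

lemma sum_sq_sum_mul {κ ι : Type*} [Fintype κ] [Fintype ι] (A : κ → ι → ℝ) (x : ι → ℝ) :
    ∑ k, (∑ e, A k e * x e) ^ 2 = ∑ e, ∑ f, (∑ k, A k e * A k f) * (x e * x f) := by
  simp only [sum_mul]
  rw [sum_comm_cycle]
  refine sum_congr rfl fun k _ => ?_
  rw [sq, sum_mul_sum, sum_comm]
  exact sum_congr rfl fun e _ => sum_congr rfl fun f _ => by ring

section QuadraticForm

variable {Ω ι : Type*} [MeasurableSpace Ω] {μ : Measure Ω} {ξ : ι → Ω → ℝ}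

lemma integral_mul_eq_zero_of_notMem [DecidableEq ι] (hind : iIndepFun ξ μ)
    (hm : ∀ i, Measurable (ξ i)) (h0 : ∀ i, ∫ ω, ξ i ω ∂μ = 0) {e f g h : ι}
    (hf : e ≠ f) (hg : e ≠ g) (hh : e ≠ h) :
    ∫ ω, ξ e ω * (ξ f ω * ξ g ω * ξ h ω) ∂μ = 0 := by
  have hd : Disjoint ({e} : Finset ι) {f, g, h} := by simp [hf, hg, hh]
  have hI := hind.indepFun_finset _ _ hd hm
  have hφ : Measurable fun x : ({e} : Finset ι) → ℝ => x ⟨e, by simp⟩ := measurable_pi_apply _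
  have hψ : Measurable fun x : ({f, g, h} : Finset ι) → ℝ =>
      x ⟨f, by simp⟩ * x ⟨g, by simp⟩ * x ⟨h, by simp⟩ := by
    refine .mul (.mul ?_ ?_) ?_ <;> exact measurable_pi_apply _
  have hc := hI.comp hφ hψ
  have := hc.integral_fun_mul_eq_mul_integral
    (Measurable.aestronglyMeasurable (by fun_prop))
    (Measurable.aestronglyMeasurable (by fun_prop))
  simpa [Function.comp_def, h0] using this

lemma integral_mul_mul_mul [DecidableEq ι] (hind : iIndepFun ξ μ)
    (hm : ∀ i, Measurable (ξ i)) (h0 : ∀ i, ∫ ω, ξ i ω ∂μ = 0) {e f g h : ι}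
    (hef : e ≠ f) (hgh : g ≠ h) :
    ∫ ω, (ξ e ω * ξ f ω) * (ξ g ω * ξ h ω) ∂μ =
      (if (g, h) = (e, f) then (∫ ω, ξ e ω ^ 2 ∂μ) * ∫ ω, ξ f ω ^ 2 ∂μ else 0) +
      (if (g, h) = (f, e) then (∫ ω, ξ e ω ^ 2 ∂μ) * ∫ ω, ξ f ω ^ 2 ∂μ else 0) := by
  have hsq : ∫ ω, ξ e ω ^ 2 * ξ f ω ^ 2 ∂μ = (∫ ω, ξ e ω ^ 2 ∂μ) * ∫ ω, ξ f ω ^ 2 ∂μ :=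
    ((hind.indepFun hef).comp (φ := fun x => x ^ 2) (ψ := fun x => x ^ 2)
      (by fun_prop) (by fun_prop)).integral_fun_mul_eq_mul_integral
      ((hm e).pow_const 2).aestronglyMeasurable ((hm f).pow_const 2).aestronglyMeasurable
  by_cases he : e = g ∨ e = h
  · by_cases hf : f = g ∨ f = h
    · rw [← hsq]
      rcases he with rfl | rfl <;> rcases hf with rfl | rfl
      · exact absurd rfl hef
      · rw [if_pos rfl, if_neg (by simp [hef]), add_zero]
        congr 1; ext ω; ring
      · rw [if_neg (by simp [hef]), if_pos rfl, zero_add]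
        congr 1; ext ω; ring
      · exact absurd rfl hef
    · push Not at hf
      rw [if_neg (by simp [hf.2.symm]), if_neg (by simp [hf.1.symm]), add_zero,
        ← integral_mul_eq_zero_of_notMem hind hm h0 hef.symm hf.1 hf.2]
      congr 1; ext ω; ring
  · push Not at he
    rw [if_neg (by simp [he.1.symm]), if_neg (by simp [he.2.symm]), add_zero,
      ← integral_mul_eq_zero_of_notMem hind hm h0 hef he.1 he.2]
    congr 1; ext ω; ring

lemma integral_sq_sum_offDiag [Fintype ι] [DecidableEq ι] [IsProbabilityMeasure μ]
    (hind : iIndepFun ξ μ) (hm : ∀ i, Measurable (ξ i)) (h0 : ∀ i, ∫ ω, ξ i ω ∂μ = 0)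
    (hb : ∀ i ω, |ξ i ω| ≤ 1) (W : ι → ι → ℝ) (hW : ∀ e f, W e f = W f e) :
    ∫ ω, (∑ p ∈ (univ : Finset ι).offDiag, W p.1 p.2 * (ξ p.1 ω * ξ p.2 ω)) ^ 2 ∂μ =
      ∑ p ∈ (univ : Finset ι).offDiag,
        2 * (W p.1 p.2 ^ 2 * ((∫ ω, ξ p.1 ω ^ 2 ∂μ) * ∫ ω, ξ p.2 ω ^ 2 ∂μ)) := by
  have hint : ∀ p q : ι × ι, Integrable
      (fun ω => (W p.1 p.2 * W q.1 q.2) * ((ξ p.1 ω * ξ p.2 ω) * (ξ q.1 ω * ξ q.2 ω))) μ := by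
    intro p q
    refine Integrable.const_mul (Integrable.of_bound
      (Measurable.aestronglyMeasurable (by fun_prop)) 1 (ae_of_all _ fun ω => ?_)) _
    simp only [norm_mul, Real.norm_eq_abs]
    have h2 : ∀ p : ι × ι, |ξ p.1 ω| * |ξ p.2 ω| ≤ 1 := fun p =>
      mul_le_one₀ (hb _ _) (abs_nonneg _) (hb _ _)
    exact mul_le_one₀ (h2 p) (by positivity) (h2 q)
  have hexp : ∀ ω, (∑ p ∈ (univ : Finset ι).offDiag, W p.1 p.2 * (ξ p.1 ω * ξ p.2 ω)) ^ 2 =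
      ∑ p ∈ (univ : Finset ι).offDiag, ∑ q ∈ (univ : Finset ι).offDiag,
        (W p.1 p.2 * W q.1 q.2) * ((ξ p.1 ω * ξ p.2 ω) * (ξ q.1 ω * ξ q.2 ω)) := by
    intro ω
    rw [sq, sum_mul_sum]
    exact sum_congr rfl fun p _ => sum_congr rfl fun q _ => by ring
  simp_rw [hexp]
  rw [integral_finsetSum _ fun p _ => integrable_finsetSum _ fun q _ => hint p q]
  refine sum_congr rfl fun p hp => ?_
  rw [integral_finsetSum _ fun q _ => hint p q]
  have hp' : p.1 ≠ p.2 := by simpa using hp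
  have hq : ∀ q ∈ (univ : Finset ι).offDiag,
      ∫ ω, (W p.1 p.2 * W q.1 q.2) * ((ξ p.1 ω * ξ p.2 ω) * (ξ q.1 ω * ξ q.2 ω)) ∂μ =
      (if q = p then W p.1 p.2 * W q.1 q.2 *
        ((∫ ω, ξ p.1 ω ^ 2 ∂μ) * ∫ ω, ξ p.2 ω ^ 2 ∂μ) else 0) +
      (if q = p.swap then W p.1 p.2 * W q.1 q.2 *
        ((∫ ω, ξ p.1 ω ^ 2 ∂μ) * ∫ ω, ξ p.2 ω ^ 2 ∂μ) else 0) := by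
    intro q hq
    rw [integral_const_mul, integral_mul_mul_mul hind hm h0 hp' (by simpa using hq), mul_add,
      mul_ite, mul_ite, mul_zero]
    rfl
  rw [sum_congr rfl hq, sum_add_distrib, sum_ite_eq', sum_ite_eq', if_pos hp,
    if_pos (by simpa using hp'.symm)]
  simp only [Prod.fst_swap, Prod.snd_swap, hW p.2 p.1]
  ring

lemma integral_sq_sum_diag_le [Fintype ι] [IsProbabilityMeasure μ]
    (hind : iIndepFun ξ μ) (hm : ∀ i, Measurable (ξ i)) (hb : ∀ i ω, |ξ i ω| ≤ 1)
    (w : ι → ℝ) :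
    ∫ ω, (∑ e, w e * ξ e ω ^ 2 - ∑ e, w e * ∫ ω, ξ e ω ^ 2 ∂μ) ^ 2 ∂μ ≤
      ∑ e, w e ^ 2 * ∫ ω, ξ e ω ^ 2 ∂μ := by
  have hb2 : ∀ i ω, ξ i ω ^ 2 ≤ 1 := fun i ω => (sq_le_one_iff_abs_le_one _).2 (hb i ω)
  have hLp : ∀ e, MemLp (fun ω => w e * ξ e ω ^ 2) 2 μ := fun e =>
    (MemLp.of_bound (Measurable.aestronglyMeasurable (by fun_prop)) 1
      (ae_of_all _ fun ω => by simpa using hb2 e ω)).const_mul _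
  have hint : ∀ e, Integrable (fun ω => ξ e ω ^ 2) μ := fun e =>
    Integrable.of_bound (Measurable.aestronglyMeasurable (by fun_prop)) 1
      (ae_of_all _ fun ω => by simpa using hb2 e ω)
  have hvar := IndepFun.variance_sum (μ := μ) (X := fun e ω => w e * ξ e ω ^ 2) (s := univ)
    (fun e _ => hLp e) (fun e _ f _ hef => (hind.indepFun hef).comp
      (φ := fun x => w e * x ^ 2) (ψ := fun x => w f * x ^ 2) (by fun_prop) (by fun_prop))
  rw [variance_eq_integral (by fun_prop)] at hvar
  have hmean : ∫ ω, (∑ e, fun ω => w e * ξ e ω ^ 2) ω ∂μ = ∑ e, w e * ∫ ω, ξ e ω ^ 2 ∂μ := by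
    simp only [Finset.sum_apply]
    rw [integral_finsetSum _ fun e _ => (hint e).const_mul _]
    simp [integral_const_mul]
  rw [hmean] at hvar
  simp only [Finset.sum_apply] at hvar
  rw [hvar]
  refine sum_le_sum fun e _ => ?_
  refine (variance_le_expectation_sq (hLp e).aestronglyMeasurable).trans ?_
  rw [← integral_const_mul]
  refine integral_mono_of_nonneg (ae_of_all _ fun ω => sq_nonneg (w e * ξ e ω ^ 2))
    ((hint e).const_mul _) (ae_of_all _ fun ω => ?_)
  simp only [Pi.pow_apply, mul_pow]
  exact mul_le_mul_of_nonneg_left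
    (pow_le_of_le_one (sq_nonneg _) (hb2 e ω) two_ne_zero) (sq_nonneg _)

/-- Second moment bound for the deviation of a quadratic form in bounded independent centred
random variables from its mean. -/
theorem integral_sq_quadraticForm_sub_le [Fintype ι] [IsProbabilityMeasure μ]
    (hind : iIndepFun ξ μ) (hm : ∀ i, Measurable (ξ i)) (h0 : ∀ i, ∫ ω, ξ i ω ∂μ = 0)
    (hb : ∀ i ω, |ξ i ω| ≤ 1) (W : ι → ι → ℝ) (hW : ∀ e f, W e f = W f e) :
    ∫ ω, (∑ e, ∑ f, W e f * (ξ e ω * ξ f ω) - ∑ e, W e e * ∫ ω, ξ e ω ^ 2 ∂μ) ^ 2 ∂μ ≤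
      2 * ∑ e, W e e ^ 2 * ∫ ω, ξ e ω ^ 2 ∂μ +
      4 * ∑ e, ∑ f, W e f ^ 2 * ((∫ ω, ξ e ω ^ 2 ∂μ) * ∫ ω, ξ f ω ^ 2 ∂μ) := by
  classical
  set v : ι → ℝ := fun e => ∫ ω, ξ e ω ^ 2 ∂μ with hv
  have hv0 : ∀ e, 0 ≤ v e := fun e => integral_nonneg fun ω => sq_nonneg _
  set D : Ω → ℝ := fun ω => ∑ e, W e e * ξ e ω ^ 2 - ∑ e, W e e * v e with hD
  set O : Ω → ℝ := fun ω => ∑ p ∈ (univ : Finset ι).offDiag, W p.1 p.2 * (ξ p.1 ω * ξ p.2 ω)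
    with hO
  have hsplit : ∀ F : ι → ι → ℝ, ∑ e, ∑ f, F e f =
      ∑ e, F e e + ∑ p ∈ (univ : Finset ι).offDiag, F p.1 p.2 := by
    intro F
    rw [← sum_product' univ univ F, ← diag_union_offDiag,
      sum_union (disjoint_diag_offDiag _), sum_diag]
  have hDO : ∀ ω, (∑ e, ∑ f, W e f * (ξ e ω * ξ f ω) - ∑ e, W e e * v e) ^ 2 ≤
      2 * D ω ^ 2 + 2 * O ω ^ 2 := by
    intro ω
    have : ∑ e, ∑ f, W e f * (ξ e ω * ξ f ω) - ∑ e, W e e * v e = D ω + O ω := by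
      rw [hsplit]
      simp only [hD, hO, sq]
      ring
    rw [this]
    nlinarith [sq_nonneg (D ω - O ω)]
  have hLp : ∀ e f, MemLp (fun ω => W e f * (ξ e ω * ξ f ω)) 2 μ := fun e f =>
    (MemLp.of_bound (Measurable.aestronglyMeasurable (by fun_prop)) 1
      (ae_of_all _ fun ω => by
        simpa using mul_le_one₀ (hb e ω) (abs_nonneg _) (hb f ω))).const_mul _
  have hDi : Integrable (fun ω => D ω ^ 2) μ := by
    refine MemLp.integrable_sq (MemLp.sub (memLp_finsetSum _ fun e _ => ?_) (memLp_const _))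
    simpa only [sq] using hLp e e
  have hOi : Integrable (fun ω => O ω ^ 2) μ :=
    MemLp.integrable_sq (memLp_finsetSum _ fun p _ => hLp p.1 p.2)
  calc _ ≤ ∫ ω, (2 * D ω ^ 2 + 2 * O ω ^ 2) ∂μ :=
        integral_mono_of_nonneg (ae_of_all _ fun ω => sq_nonneg _)
          ((hDi.const_mul 2).add (hOi.const_mul 2)) (ae_of_all _ hDO)
    _ = 2 * ∫ ω, D ω ^ 2 ∂μ + 2 * ∫ ω, O ω ^ 2 ∂μ := by
        rw [integral_add (hDi.const_mul 2) (hOi.const_mul 2), integral_const_mul,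
          integral_const_mul]
    _ ≤ _ := by
        have h1 := integral_sq_sum_diag_le hind hm hb fun e => W e e
        have h2 := integral_sq_sum_offDiag hind hm h0 hb W hW
        rw [hsplit fun e f => W e f ^ 2 * (v e * v f)]
        have h3 : 0 ≤ ∑ e, W e e ^ 2 * (v e * v e) :=
          sum_nonneg fun e _ => mul_nonneg (sq_nonneg _) (mul_nonneg (hv0 e) (hv0 e))
        rw [← mul_sum] at h2
        simp only [hD, hO, hv] at h1 h2 h3 ⊢
        linarith

end QuadraticForm

section Bernoulli

lemma isProbabilityMeasure_bern {p : ℝ} (h0 : 0 ≤ p) (h1 : p ≤ 1) :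
    IsProbabilityMeasure (bern p) := by
  constructor
  simp only [bern, Measure.add_apply, Measure.smul_apply, measure_univ]
  rw [ENNReal.smul_def, ENNReal.smul_def, smul_eq_mul, smul_eq_mul, mul_one, mul_one,
    ← ENNReal.coe_add, ← Real.toNNReal_add h0 (by linarith)]
  simp

lemma integral_bern {p : ℝ} (h0 : 0 ≤ p) (h1 : p ≤ 1) (f : Bool → ℝ) :
    ∫ x, f x ∂(bern p) = p * f true + (1 - p) * f false := by
  rw [bern, integral_add_measure .of_finite .of_finite, integral_smul_nnreal_measure,
    integral_smul_nnreal_measure, integral_dirac, integral_dirac, NNReal.smul_def,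
    NNReal.smul_def, Real.coe_toNNReal _ h0, Real.coe_toNNReal _ (by linarith)]
  rfl

variable {κ : Type*} [Fintype κ] {P : κ → κ → ℝ}

lemma integral_pi_pi_bern (h0 : ∀ i j, 0 ≤ P i j) (h1 : ∀ i j, P i j ≤ 1) (i j : κ)
    (f : Bool → ℝ) :
    ∫ ω, f (ω i j) ∂(Measure.pi fun i => Measure.pi fun j => bern (P i j)) =
      P i j * f true + (1 - P i j) * f false := by
  have := fun i j => isProbabilityMeasure_bern (h0 i j) (h1 i j)
  rw [← integral_bern (h0 i j) (h1 i j) f]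
  have hmp := (measurePreserving_eval (fun j => bern (P i j)) j).comp
    (measurePreserving_eval (fun i => Measure.pi fun j => bern (P i j)) i)
  rw [← hmp.map_eq, integral_map hmp.measurable.aemeasurable
    (Measurable.of_discrete).aestronglyMeasurable]
  rfl

lemma iIndepFun_pi_pi_bern (h0 : ∀ i j, 0 ≤ P i j) (h1 : ∀ i j, P i j ≤ 1)
    (f : κ → κ → Bool → ℝ) :
    iIndepFun (fun (e : κ × κ) (ω : κ → κ → Bool) => f e.1 e.2 (ω e.1 e.2))
      (Measure.pi fun i => Measure.pi fun j => bern (P i j)) := by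
  have := fun i j => isProbabilityMeasure_bern (h0 i j) (h1 i j)
  have h := iIndepFun_uncurry_infinitePi' (fun i j => bern (P i j)) (X := f)
    fun _ _ => Measurable.of_discrete
  simpa only [Measure.infinitePi_eq_pi] using h

end Bernoulli

section Degree

/-- The incidence between a vertex and an unordered pair `{i, j}`, encoded by `i ≤ j`. -/
def incidence {m : ℕ} (k : Fin m) (e : Fin m × Fin m) : ℝ :=
  if e.1 ≤ e.2 ∧ (e.1 = k ∨ e.2 = k) then 1 else 0

variable {m : ℕ}

lemma incidence_nonneg (k : Fin m) (e : Fin m × Fin m) : 0 ≤ incidence k e := by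
  unfold incidence; positivity

lemma incidence_le_one (k : Fin m) (e : Fin m × Fin m) : incidence k e ≤ 1 := by
  unfold incidence; split_ifs <;> norm_num

lemma sum_incidence_mul (x : Fin m → Fin m → ℝ) (k : Fin m) :
    ∑ e, incidence k e * x e.1 e.2 = ∑ j, if k ≤ j then x k j else x j k := by
  have h : ∀ i j, incidence k (i, j) * x i j =
      (if i = k then (if k ≤ j then x k j else 0) else 0) +
      (if j = k then (if k ≤ i then 0 else x i k) else 0) := by
    intro i j
    unfold incidence
    by_cases hi : i = k
    · subst hi; by_cases hj : j = i
      · subst hj; simp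
      · by_cases hij : i ≤ j <;> simp [hj, hij]
    · by_cases hj : j = k
      · subst hj
        by_cases hij : j ≤ i
        · simp [hi, hij, (lt_of_le_of_ne hij (Ne.symm hi)).not_ge]
        · simp [hi, hij, (not_le.1 hij).le]
      · simp [hi, hj]
  rw [Fintype.sum_prod_type]
  simp only [h, sum_add_distrib]
  rw [sum_comm]
  simp only [sum_ite_eq', mem_univ, if_true]
  rw [← sum_add_distrib]
  refine sum_congr rfl fun j _ => ?_
  split_ifs <;> simp

lemma sum_incidence_le_two (e : Fin m × Fin m) : ∑ k, incidence k e ≤ 2 := by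
  calc ∑ k, incidence k e ≤ ∑ k, ((if e.1 = k then 1 else 0) + (if e.2 = k then 1 else 0)) := by
        refine sum_le_sum fun k _ => ?_
        unfold incidence
        split_ifs <;> simp_all
    _ = 2 := by
        rw [sum_add_distrib, sum_ite_eq, sum_ite_eq]
        norm_num

lemma deg_eq_sum_incidence (ω : Fin m → Fin m → Bool) (k : Fin m) :
    deg ω k = ∑ e, incidence k e * (if ω e.1 e.2 then 1 else 0) :=
  (sum_incidence_mul (fun i j => if ω i j then 1 else 0) k).symm

lemma deg_nonneg (ω : Fin m → Fin m → Bool) (k : Fin m) : 0 ≤ deg ω k := by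
  rw [deg_eq_sum_incidence]
  exact sum_nonneg fun e _ => mul_nonneg (incidence_nonneg k e) (by positivity)

/-- In a random graph with independent edges and constant expected degree `d`, the sum of the
squared degree deviations exceeds `2 m d` with probability at most `12 / m` (for `d ≥ 1`). -/
theorem measure_sum_sq_deg_sub_gt_le {P : Fin m → Fin m → ℝ} (h0 : ∀ i j, 0 ≤ P i j)
    (h1 : ∀ i j, P i j ≤ 1) (hsymm : ∀ i j, P i j = P j i) {d : ℝ} (hd : 1 ≤ d)
    (hdeg : ∀ i, ∑ j, P i j = d) (hpos : 0 < m) :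
    (Measure.pi fun i => Measure.pi fun j => bern (P i j)).real
      {ω | 2 * m * d < ∑ k, (d - deg ω k) ^ 2} ≤ 12 / m := by
  have := fun i j => isProbabilityMeasure_bern (h0 i j) (h1 i j)
  set μ := Measure.pi fun i => Measure.pi fun j => bern (P i j) with hμ
  let g : Fin m → Fin m → Bool → ℝ := fun i j x => (if x then 1 else 0) - P i j
  let ξ : Fin m × Fin m → (Fin m → Fin m → Bool) → ℝ := fun e ω => g e.1 e.2 (ω e.1 e.2)
  let W : Fin m × Fin m → Fin m × Fin m → ℝ := fun e f => ∑ k, incidence k e * incidence k f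
  have hind : iIndepFun ξ μ := iIndepFun_pi_pi_bern h0 h1 g
  have hmean : ∀ e, ∫ ω, ξ e ω ∂μ = 0 := fun e => by
    rw [integral_pi_pi_bern h0 h1 e.1 e.2 (g e.1 e.2)]
    simp only [g, if_true, Bool.false_eq_true, if_false]
    ring
  have hb : ∀ e ω, |ξ e ω| ≤ 1 := by
    intro e ω
    have := h0 e.1 e.2
    have := h1 e.1 e.2
    simp only [ξ, g]
    rw [abs_le]
    split_ifs <;> constructor <;> linarith
  set v : Fin m × Fin m → ℝ := fun e => ∫ ω, ξ e ω ^ 2 ∂μ with hv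
  have hv0 : ∀ e, 0 ≤ v e := fun e => integral_nonneg fun ω => sq_nonneg _
  have hvP : ∀ e, v e ≤ P e.1 e.2 := fun e => by
    simp only [hv, ξ]
    rw [integral_pi_pi_bern h0 h1 e.1 e.2 fun x => g e.1 e.2 x ^ 2]
    simp only [g, if_true, Bool.false_eq_true, if_false]
    nlinarith [sq_nonneg (P e.1 e.2)]
  have hPsum : ∀ k, ∑ e, incidence k e * P e.1 e.2 = d := fun k => by
    rw [sum_incidence_mul, ← hdeg k]
    exact sum_congr rfl fun j _ => by rw [hsymm j k, ite_self]
  have hvsum : ∀ k, ∑ e, incidence k e * v e ≤ d := fun k => by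
    rw [← hPsum k]
    exact sum_le_sum fun e _ => mul_le_mul_of_nonneg_left (hvP e) (incidence_nonneg k e)
  have hvsum0 : ∀ k, 0 ≤ ∑ e, incidence k e * v e := fun k =>
    sum_nonneg fun e _ => mul_nonneg (incidence_nonneg k e) (hv0 e)
  have hW0 : ∀ e f, 0 ≤ W e f := fun e f =>
    sum_nonneg fun k _ => mul_nonneg (incidence_nonneg k e) (incidence_nonneg k f)
  have hW2 : ∀ e f, W e f ≤ 2 := fun e f =>
    (sum_le_sum fun k _ => mul_le_of_le_one_right (incidence_nonneg k e)
      (incidence_le_one k f)).trans (sum_incidence_le_two e)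
  have hWsq : ∀ e f, W e f ^ 2 ≤ 2 * W e f := fun e f => by nlinarith [hW0 e f, hW2 e f]
  have hdiag : ∑ e, W e e * v e ≤ m * d := by
    calc ∑ e, W e e * v e ≤ ∑ e, ∑ k, incidence k e * v e := by
          refine sum_le_sum fun e _ => ?_
          rw [← sum_mul]
          exact mul_le_mul_of_nonneg_right (sum_le_sum fun k _ => mul_le_of_le_one_right
            (incidence_nonneg k e) (incidence_le_one k e)) (hv0 e)
      _ = ∑ k, ∑ e, incidence k e * v e := sum_comm
      _ ≤ ∑ _k : Fin m, d := sum_le_sum fun k _ => hvsum k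
      _ = m * d := by simp
  have hdiag2 : ∑ e, W e e ^ 2 * v e ≤ 2 * (m * d) := by
    calc ∑ e, W e e ^ 2 * v e ≤ ∑ e, 2 * (W e e * v e) := sum_le_sum fun e _ => by
          nlinarith [mul_le_mul_of_nonneg_right (hWsq e e) (hv0 e)]
      _ ≤ 2 * (m * d) := by rw [← mul_sum]; linarith
  have hfull : ∑ e, ∑ f, W e f * (v e * v f) ≤ m * d ^ 2 := by
    calc ∑ e, ∑ f, W e f * (v e * v f)
        = ∑ k, (∑ e, incidence k e * v e) ^ 2 := (sum_sq_sum_mul incidence v).symm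
      _ ≤ ∑ _k : Fin m, d ^ 2 := sum_le_sum fun k _ => pow_le_pow_left₀ (hvsum0 k) (hvsum k) 2
      _ = m * d ^ 2 := by simp
  have hfull2 : ∑ e, ∑ f, W e f ^ 2 * (v e * v f) ≤ 2 * (m * d ^ 2) := by
    calc _ ≤ ∑ e, ∑ f, 2 * (W e f * (v e * v f)) :=
          sum_le_sum fun e _ => sum_le_sum fun f _ => by
            nlinarith [mul_le_mul_of_nonneg_right (hWsq e f) (mul_nonneg (hv0 e) (hv0 f))]
      _ ≤ 2 * (m * d ^ 2) := by simp only [← mul_sum]; linarith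
  have hquad : ∀ ω, ∑ k, (d - deg ω k) ^ 2 = ∑ e, ∑ f, W e f * (ξ e ω * ξ f ω) := by
    intro ω
    have hk : ∀ k, d - deg ω k = -∑ e, incidence k e * ξ e ω := fun k => by
      rw [← hPsum k, deg_eq_sum_incidence, ← sum_sub_distrib, ← sum_neg_distrib]
      exact sum_congr rfl fun e _ => by simp only [ξ, g]; ring
    simp only [hk, neg_sq]
    exact sum_sq_sum_mul incidence fun e => ξ e ω
  have hmoment := integral_sq_quadraticForm_sub_le hind (fun e => Measurable.of_discrete) hmean hb W
    fun e f => sum_congr rfl fun k _ => mul_comm _ _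
  have hm0 : (0 : ℝ) < m := by exact_mod_cast hpos
  set F : (Fin m → Fin m → Bool) → ℝ := fun ω =>
    (∑ e, ∑ f, W e f * (ξ e ω * ξ f ω) - ∑ e, W e e * v e) ^ 2 with hF
  have hFint : ∫ ω, F ω ∂μ ≤ 12 * (m * d ^ 2) := by
    refine hmoment.trans ?_
    have : m * d ≤ m * d ^ 2 := mul_le_mul_of_nonneg_left (by nlinarith) hm0.le
    linarith
  have hmarkov := mul_meas_ge_le_integral_of_nonneg (μ := μ) (f := F)
    (ae_of_all _ fun ω => sq_nonneg _) .of_finite ((m * d) ^ 2)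
  have hsub : {ω | 2 * m * d < ∑ k, (d - deg ω k) ^ 2} ⊆ {ω | (m * d) ^ 2 ≤ F ω} := by
    intro ω hω
    simp only [Set.mem_ofPred_eq, hquad] at hω ⊢
    exact pow_le_pow_left₀ (by positivity) (by linarith) 2
  have hle := measureReal_mono (μ := μ) hsub
  rw [le_div_iff₀ hm0]
  have hmd : (0 : ℝ) < m * d ^ 2 := by positivity
  refine le_of_mul_le_mul_right ?_ hmd
  calc _ = (m * d) ^ 2 * μ.real {ω | 2 * m * d < ∑ k, (d - deg ω k) ^ 2} := by ring
    _ ≤ (m * d) ^ 2 * μ.real {ω | (m * d) ^ 2 ≤ F ω} := by gcongr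
    _ ≤ _ := hmarkov.trans hFint

end Degree

lemma sum_blockProb {n : ℕ} (hn : 0 < n) (a b : ℝ) (i : Fin (2 * n)) :
    ∑ j : Fin (2 * n), (if i.val < n ↔ j.val < n then a / n else b / n) = a + b := by
  have hn' : (n : ℝ) ≠ 0 := by positivity
  generalize i.val = k
  rw [Fin.sum_univ_eq_sum_range (fun j => if k < n ↔ j < n then a / n else b / (n : ℝ)),
    two_mul, sum_range_add]
  have hlow : ∀ j ∈ range n, (if k < n ↔ j < n then a / n else b / (n : ℝ)) =
      if k < n then a / n else b / n := fun j hj => by simp [mem_range.1 hj]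
  have hhigh : ∀ j ∈ range n, (if k < n ↔ n + j < n then a / n else b / (n : ℝ)) =
      if k < n then b / n else a / n := fun j _ => by by_cases h : k < n <;> simp [h]
  rw [sum_congr rfl hlow, sum_congr rfl hhigh, sum_const, sum_const, card_range]
  split_ifs <;> simp only [nsmul_eq_mul] <;> field_simp
  ring

lemma mul_sq_sqrt_sub_sqrt_le {d x : ℝ} (hd : 0 ≤ d) (hx : 0 ≤ x) :
    d * (√d - √x) ^ 2 ≤ (d - x) ^ 2 := by
  have h : (d - x) ^ 2 = (√d + √x) ^ 2 * (√d - √x) ^ 2 := by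
    rw [← mul_pow, ← sq_sub_sq, Real.sq_sqrt hd, Real.sq_sqrt hx]
  rw [h]
  gcongr
  nlinarith [Real.sq_sqrt hd, Real.sqrt_nonneg d, Real.sqrt_nonneg x]

/-- There is a constant `c > 0` such that for every `ε > 0` and all
sufficiently large `n`: if `a, b ≥ 1` and `d := a + b` satisfies `5·log n < d < n^{1/3-ε}`,
then for `G ∼ G_{2n,a/n,b/n}`, with probability at least `1 - n^{-c}` we have
`∑_j (√d - √(d_j))² ≤ 4n`. -/
theorem stmt7 : ∃ c > (0:ℝ), ∀ ε > (0:ℝ), ∃ N0 : ℕ, ∀ n : ℕ, N0 ≤ n →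
    ∀ a b : ℝ, 1 ≤ a → 1 ≤ b → 5 * Real.log n < a + b →
      a + b < (n : ℝ) ^ ((1:ℝ)/3 - ε) →
    ENNReal.ofReal (1 - (n : ℝ) ^ (-c)) ≤
      sbm n (a / n) (b / n)
        {ω | ∑ j, (Real.sqrt (a + b) - Real.sqrt (deg ω j)) ^ 2 ≤ 4 * n} := by
  refine ⟨1 / 2, by norm_num, fun ε hε => ⟨36, fun n hn a b ha hb _ hd => ?_⟩⟩
  have hn36 : (36 : ℝ) ≤ n := by exact_mod_cast hn
  have hn0 : (0 : ℝ) < n := by linarith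
  have hdn : a + b ≤ n := hd.le.trans <| by
    simpa using Real.rpow_le_rpow_of_exponent_le (by linarith : (1 : ℝ) ≤ n)
      (by linarith : (1 : ℝ) / 3 - ε ≤ 1)
  have h0 : ∀ i j : Fin (2 * n), 0 ≤ if i.val < n ↔ j.val < n then a / n else b / n :=
    fun i j => by split_ifs <;> positivity
  have h1 : ∀ i j : Fin (2 * n), (if i.val < n ↔ j.val < n then a / n else b / n) ≤ 1 :=
    fun i j => by split_ifs <;> rw [div_le_one hn0] <;> linarith
  have hprob := fun i j => isProbabilityMeasure_bern (h0 i j) (h1 i j)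
  have : IsProbabilityMeasure (sbm n (a / n) (b / n)) := by unfold sbm; infer_instance
  have hbad := measure_sum_sq_deg_sub_gt_le h0 h1
    (fun i j => by simp only [Iff.comm]) (by linarith : 1 ≤ a + b)
    (sum_blockProb (by omega) a b) (by omega)
  change (sbm n (a / n) (b / n)).real _ ≤ _ at hbad
  have hsub : {ω : Fin (2 * n) → Fin (2 * n) → Bool |
      ∑ j, (√(a + b) - √(deg ω j)) ^ 2 ≤ 4 * n}ᶜ ⊆
      {ω | 2 * ((2 * n : ℕ) : ℝ) * (a + b) < ∑ k, (a + b - deg ω k) ^ 2} := by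
    intro ω hω
    simp only [Set.mem_compl_iff, Set.mem_ofPred_eq, not_le] at hω ⊢
    calc 2 * ((2 * n : ℕ) : ℝ) * (a + b) = (a + b) * (4 * n) := by push_cast; ring
      _ < (a + b) * ∑ j, (√(a + b) - √(deg ω j)) ^ 2 := by gcongr
      _ ≤ _ := by
        rw [mul_sum]
        exact sum_le_sum fun j _ => mul_sq_sqrt_sub_sqrt_le (by linarith) (deg_nonneg ω j)
  have hcompl := (measureReal_mono (μ := sbm n (a / n) (b / n)) hsub).trans hbad
  rw [probReal_compl_eq_one_sub (Set.toFinite _).measurableSet] at hcompl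
  have hpow : 12 / ((2 * n : ℕ) : ℝ) ≤ (n : ℝ) ^ (-(1 / 2 : ℝ)) := by
    rw [Real.rpow_neg hn0.le, ← Real.sqrt_eq_rpow, ← one_div, le_div_iff₀ (by positivity)]
    have h6 : 6 ≤ √(n : ℝ) := Real.le_sqrt_of_sq_le (by linarith)
    push_cast
    rw [div_mul_eq_mul_div, div_le_one (by positivity)]
    nlinarith [Real.sq_sqrt hn0.le]
  refine ENNReal.ofReal_le_of_le_toReal ?_
  change _ ≤ (sbm n (a / n) (b / n)).real _
  linarith
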